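/- arXiv:2504.14213 — 4 statements merged into one kernel-verified Lean document; each statement's English description precedes it below -/
import Mathlib

section
/- Let (X,d) be a metric space with |X| ≥ n ≥ 2 in which every point is an accumulation point, and let T : X → X be continuous and satisfy: there exists λ ∈ [0,(n−1)/n) with S(Tx₁,…,Txₙ) ≤ λ·Σᵢ₌₁ⁿ d(xᵢ,Txᵢ) for all pairwise distinct x₁,…,xₙ ∈ X. Then T is a Kannan contraction; more precisely, d(Tz,Ty) ≤ (nλ/(2(n−1)))·(d(z,Tz) + d(y,Ty)) for all y,z ∈ X, where nλ/(2(n−1)) ∈ [0,1/2). -/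
open Finset Filter Topology

/-- The sum of all pairwise distances between the points `x 0, …, x (n-1)`. -/
noncomputable def pairSum {X : Type*} [MetricSpace X] {n : ℕ} (x : Fin n → X) : ℝ :=
  ∑ i : Fin n, ∑ j ∈ Finset.Ioi i, dist (x i) (x j)

/-- If every point is the limit of an injective sequence, then the `n`-tuples of pairwise
distinct points are dense among all `n`-tuples. -/
theorem dense_injective_of_accumulation {X : Type*} [MetricSpace X]
    (hacc : ∀ z : X, ∃ u : ℕ → X, Function.Injective u ∧ (∀ m, u m ≠ z) ∧
      Filter.Tendsto u Filter.atTop (nhds z)) (n : ℕ) :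
    Dense {x : Fin n → X | Function.Injective x} := by
  classical
  intro x
  rw [Metric.mem_closure_iff]
  intro ε hε
  have hex (i : Fin n) : ∃ t : Finset X, t.card = n ∧ ∀ p ∈ t, dist (x i) p < ε := by
    obtain ⟨u, hu, -, hlim⟩ := hacc (x i)
    obtain ⟨N, hN⟩ := Metric.tendsto_atTop.1 hlim ε hε
    refine ⟨(Finset.Ico N (N + n)).image u, ?_, ?_⟩
    · simp [Finset.card_image_of_injective _ hu]
    · intro p hp
      obtain ⟨m, hm, rfl⟩ := Finset.mem_image.1 hp
      rw [dist_comm]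
      exact hN m (Finset.mem_Ico.1 hm).1
  choose t ht htε using hex
  obtain ⟨f, hf, hft⟩ := (Finset.all_card_le_biUnion_card_iff_exists_injective t).1 (by
    intro s
    obtain rfl | ⟨i, hi⟩ := s.eq_empty_or_nonempty
    · simp
    · calc s.card ≤ n := by simpa using s.card_le_univ
        _ = (t i).card := (ht i).symm
        _ ≤ (s.biUnion t).card := Finset.card_le_card (Finset.subset_biUnion_of_mem t hi))
  exact ⟨f, hf, (dist_pi_lt_iff hε).2 fun i => htε i _ (hft i)⟩

theorem continuous_pairSum {X : Type*} [MetricSpace X] {n : ℕ} :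
    Continuous (pairSum : (Fin n → X) → ℝ) := by
  unfold pairSum
  fun_prop

/-- The pairwise distance sum of a point followed by `m` copies of another point. -/
theorem pairSum_cons_const {X : Type*} [MetricSpace X] (m : ℕ) (a b : X) :
    pairSum (Fin.cons a fun _ => b : Fin (m + 1) → X) = m * dist a b := by
  simp [pairSum, Fin.sum_univ_succ, Fin.sum_Ioi_succ]

/-- If every point of `X` is an accumulation point and `T` is a continuous `n`-point
Kannan-type mapping, then `T` is a Kannan contraction with constant
`nλ/(2(n−1)) ∈ [0, 1/2)`. -/
theorem statement2 {X : Type*} [MetricSpace X] (n : ℕ) (hn : 2 ≤ n)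
    (hcard : ∃ f : Fin n → X, Function.Injective f)
    (hacc : ∀ z : X, ∃ u : ℕ → X, Function.Injective u ∧ (∀ m, u m ≠ z) ∧
      Filter.Tendsto u Filter.atTop (nhds z))
    (T : X → X) (hTc : Continuous T)
    (lam : ℝ) (hlam0 : 0 ≤ lam) (hlam1 : lam < ((n : ℝ) - 1) / n)
    (hK : ∀ x : Fin n → X, Function.Injective x →
      pairSum (fun i => T (x i)) ≤ lam * ∑ i : Fin n, dist (x i) (T (x i))) :
    (∀ z y : X, dist (T z) (T y) ≤
      (n : ℝ) * lam / (2 * ((n : ℝ) - 1)) * (dist z (T z) + dist y (T y))) ∧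
    0 ≤ (n : ℝ) * lam / (2 * ((n : ℝ) - 1)) ∧
    (n : ℝ) * lam / (2 * ((n : ℝ) - 1)) < 1 / 2 := by
  have hn2 : (2 : ℝ) ≤ n := by exact_mod_cast hn
  rw [lt_div_iff₀ (by linarith)] at hlam1
  have hall (x : Fin n → X) :
      pairSum (fun i => T (x i)) ≤ lam * ∑ i : Fin n, dist (x i) (T (x i)) := by
    have hclosed : IsClosed {x : Fin n → X |
        pairSum (fun i => T (x i)) ≤ lam * ∑ i : Fin n, dist (x i) (T (x i))} :=
      isClosed_le (continuous_pairSum.comp (by fun_prop)) (by fun_prop)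
    exact closure_minimal hK hclosed (dense_injective_of_accumulation hacc n x)
  refine ⟨fun z y => ?_, div_nonneg (by positivity) (by linarith), ?_⟩
  · obtain ⟨m, rfl⟩ : ∃ m, n = m + 1 := ⟨n - 1, by omega⟩
    push_cast at hn2 ⊢
    have key (a b : X) :
        m * dist (T a) (T b) ≤ lam * (dist a (T a) + m * dist b (T b)) := by
      have h := hall (Fin.cons a fun _ => b)
      have hcomp : (fun i => T ((Fin.cons a fun _ => b : Fin (m + 1) → X) i)) =
          Fin.cons (T a) fun _ => T b := by
        funext i
        refine Fin.cases ?_ (fun j => ?_) i <;> simp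
      rw [hcomp, pairSum_cons_const] at h
      simpa [Fin.sum_univ_succ] using h
    have h₁ := key z y
    have h₂ := key y z
    rw [dist_comm (T y) (T z)] at h₂
    rw [div_mul_eq_mul_div, le_div_iff₀ (by linarith)]
    linarith
  · rw [div_lt_iff₀ (by linarith)]
    linarith
end

section
/- Let (X,d) be a complete metric space with |X| ≥ n ≥ 2, and let T : X → X be an n-point Kannan-type mapping. Then T has a periodic point of prime period p for some p ∈ {1,2,3,…,n−1}. -/
open Finset Filter Topology

/-- Twice the sum of pairwise distances is the sum over all ordered pairs. -/
lemma two_mul_pairSum {X : Type*} [MetricSpace X] {n : ℕ} (x : Fin n → X) :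
    2 * pairSum x = ∑ i, ∑ j, dist (x i) (x j) := by
  have hrow (i : Fin n) : ∑ j, dist (x i) (x j) =
      ∑ j ∈ Ioi i, dist (x i) (x j) + ∑ j ∈ Iio i, dist (x i) (x j) := by
    rw [← Finset.sum_union]
    · symm
      apply Finset.sum_subset (Finset.subset_univ _)
      intro j _ hj
      have hij : i = j := by
        simp only [Finset.mem_union, Finset.mem_Ioi, Finset.mem_Iio, not_or, not_lt] at hj
        exact le_antisymm hj.2 hj.1
      rw [hij, dist_self]
    · rw [Finset.disjoint_left]
      intro j hj hj'
      exact lt_asymm (Finset.mem_Ioi.1 hj) (Finset.mem_Iio.1 hj')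
  have hswap : ∑ i, ∑ j ∈ Iio i, dist (x i) (x j) = ∑ i, ∑ j ∈ Ioi i, dist (x i) (x j) := by
    rw [Finset.sum_comm' (t' := Finset.univ) (s' := fun j => Ioi j) (by simp)]
    simp only [dist_comm]
  simp only [hrow, Finset.sum_add_distrib, hswap, pairSum]
  ring

/-- Among `n` points, the distance between any two is at most `1 / (n - 1)` times the sum of all
pairwise distances. -/
lemma mul_dist_le_pairSum {X : Type*} [MetricSpace X] {n : ℕ} (x : Fin n → X) {p q : Fin n}
    (hpq : p ≠ q) : ((n : ℝ) - 1) * dist (x p) (x q) ≤ pairSum x := by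
  have hrow (i : Fin n) : dist (x p) (x q) ≤ ∑ j, dist (x i) (x j) := by
    calc dist (x p) (x q) ≤ dist (x i) (x p) + dist (x i) (x q) := dist_triangle_left _ _ _
      _ = ∑ j ∈ {p, q}, dist (x i) (x j) := by
        rw [Finset.sum_pair hpq]
      _ ≤ _ := Finset.sum_le_sum_of_subset_of_nonneg (Finset.subset_univ _)
        fun _ _ _ => dist_nonneg
  have hpair : n * dist (x p) (x q) ≤ ∑ j, dist (x p) (x j) + ∑ j, dist (x q) (x j) := by
    rw [← Finset.sum_add_distrib]
    calc n * dist (x p) (x q) = ∑ _j : Fin n, dist (x p) (x q) := by simp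
      _ ≤ _ := Finset.sum_le_sum fun j _ => dist_triangle_right _ _ _
  have hrest : ((n : ℝ) - 2) * dist (x p) (x q) ≤
      ∑ i ∈ ({p, q} : Finset (Fin n))ᶜ, ∑ j, dist (x i) (x j) := by
    have h := Finset.card_nsmul_le_sum ({p, q} : Finset (Fin n))ᶜ
      (fun i => ∑ j, dist (x i) (x j)) _ fun i _ => hrow i
    have hc : (({p, q} : Finset (Fin n))ᶜ.card : ℝ) = n - 2 := by
      have := Finset.card_add_card_compl ({p, q} : Finset (Fin n))
      rw [Finset.card_pair hpq, Fintype.card_fin] at this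
      rw [eq_sub_iff_add_eq']
      exact_mod_cast this
    rwa [nsmul_eq_mul, hc] at h
  have htotal := Finset.sum_add_sum_compl ({p, q} : Finset (Fin n))
    fun i => ∑ j, dist (x i) (x j)
  rw [Finset.sum_pair hpq, ← two_mul_pairSum] at htotal
  linarith

/-- A positive period of a point bounds some prime period of that point. -/
lemma exists_prime_period_le {X : Type*} {T : X → X} {p : ℕ} (hp : 1 ≤ p) {x : X}
    (hx : T^[p] x = x) :
    ∃ q, 1 ≤ q ∧ q ≤ p ∧ T^[q] x = x ∧ ∀ k, 1 ≤ k → k < q → T^[k] x ≠ x := by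
  have hper : Function.IsPeriodicPt T p x := hx
  exact ⟨Function.minimalPeriod T x, hper.minimalPeriod_pos hp, hper.minimalPeriod_le hp,
    Function.isPeriodicPt_minimalPeriod T x, fun k hk hlt =>
      Function.not_isPeriodicPt_of_pos_of_lt_minimalPeriod (by omega) hlt⟩

/-- If any `n` consecutive iterates are distinct, an `n`-point Kannan-type mapping contracts
consecutive displacements along orbits. -/
lemma dist_map_le_of_kannan {X : Type*} [MetricSpace X] {n : ℕ} (hn : 2 ≤ n) {T : X → X}
    {lam : ℝ} (hlam0 : 0 ≤ lam) (hlam1 : lam < 1)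
    (hK : ∀ x : Fin n → X, Function.Injective x →
      pairSum (fun i => T (x i)) ≤ lam * ∑ i : Fin n, dist (x i) (T (x i)))
    {y : X} (hy : Function.Injective fun i : Fin n => T^[i] y) :
    dist (T y) (T (T y)) ≤ lam / ((1 - lam) * (n - 1)) * dist y (T y) := by
  obtain ⟨m, rfl⟩ : ∃ m, n = m + 2 := ⟨n - 2, by omega⟩
  have hS := hK _ hy
  set A := ∑ i : Fin (m + 2), dist (T^[i] y) (T (T^[i] y)) with hA
  have hstep (i : Fin (m + 1)) :
      ((m : ℝ) + 1) * dist (T^[i + 1] y) (T (T^[i + 1] y)) ≤ lam * A := by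
    have h := (mul_dist_le_pairSum (fun i : Fin (m + 2) => T (T^[i] y))
      (Fin.castSucc_lt_succ (i := i)).ne).trans hS
    simp only [Fin.val_castSucc, Fin.val_succ, ← Function.iterate_succ_apply'] at h ⊢
    push_cast at h
    linarith
  have hsplit : A = dist y (T y) +
      ∑ i : Fin (m + 1), dist (T^[i + 1] y) (T (T^[i + 1] y)) := by
    rw [hA, Fin.sum_univ_succ]
    simp
  have hm : (0 : ℝ) < m + 1 := by positivity
  have hbound : (1 - lam) * A ≤ dist y (T y) := by
    have h := Finset.sum_le_sum fun i (_ : i ∈ Finset.univ) => hstep i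
    rw [← Finset.mul_sum] at h
    simp only [Finset.sum_const, Finset.card_univ, Fintype.card_fin, nsmul_eq_mul] at h
    push_cast at h
    have := le_of_mul_le_mul_left h hm
    linarith
  have hfirst : ((m : ℝ) + 1) * dist (T y) (T (T y)) ≤ lam * A := by simpa using hstep 0
  have hl : 0 < 1 - lam := by linarith
  have hcast : (((m + 2 : ℕ) : ℝ) - 1) = m + 1 := by push_cast; ring
  rw [hcast, div_mul_eq_mul_div, le_div_iff₀ (by positivity)]
  calc dist (T y) (T (T y)) * ((1 - lam) * (m + 1))
      = (1 - lam) * (((m : ℝ) + 1) * dist (T y) (T (T y))) := by ring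
    _ ≤ (1 - lam) * (lam * A) := by gcongr
    _ = lam * ((1 - lam) * A) := by ring
    _ ≤ lam * dist y (T y) := by gcongr

/-- The limit of an orbit of distinct points with vanishing displacements is a fixed point of
an `n`-point Kannan-type mapping. -/
lemma map_eq_of_kannan_of_tendsto {X : Type*} [MetricSpace X] {n : ℕ} (hn : 2 ≤ n) {T : X → X}
    {lam : ℝ} (hlam1 : lam < 1)
    (hK : ∀ x : Fin n → X, Function.Injective x →
      pairSum (fun i => T (x i)) ≤ lam * ∑ i : Fin n, dist (x i) (T (x i)))
    {x z : X} (hx : Function.Injective fun k => T^[k] x)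
    (hz : Tendsto (fun k => T^[k] x) atTop (𝓝 z)) : T z = z := by
  obtain ⟨m, rfl⟩ : ∃ m, n = m + 2 := ⟨n - 2, by omega⟩
  have hne : ∀ᶠ k in atTop, ∀ j, k ≤ j → T^[j] x ≠ z := by
    by_cases h : ∃ k, T^[k] x = z
    · obtain ⟨k, rfl⟩ := h
      filter_upwards [eventually_gt_atTop k] with l hl j hj hjk
      have := hx hjk
      omega
    · exact Eventually.of_forall fun k j _ hj => h ⟨j, hj⟩
  have hineq : ∀ᶠ k in atTop, ((m : ℝ) + 1) * dist (T z) (T^[k + 1] x) ≤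
      lam * (dist z (T z) + ∑ i : Fin (m + 1), dist (T^[k + i] x) (T^[k + i + 1] x)) := by
    filter_upwards [hne] with k hk
    let w : Fin (m + 2) → X := Fin.cons z fun i : Fin (m + 1) => T^[k + i] x
    have hw : Function.Injective w := by
      rw [Fin.cons_injective_iff]
      refine ⟨?_, fun i j hij => ?_⟩
      · rintro ⟨i, hi⟩
        exact hk _ (by omega) hi
      · have := hx hij
        exact Fin.ext (by omega)
    have h := (mul_dist_le_pairSum (fun i => T (w i)) (p := 0) (q := Fin.succ 0)
      (Fin.succ_ne_zero 0).symm).trans (hK w hw)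
    rw [Fin.sum_univ_succ] at h
    simp only [w, Fin.cons_zero, Fin.cons_succ, ← Function.iterate_succ_apply'] at h
    push_cast at h
    simp only [Fin.val_zero, add_zero] at h
    have hcast : (m : ℝ) + 2 - 1 = m + 1 := by ring
    rwa [hcast] at h
  have hshift (c : ℕ) : Tendsto (fun k => T^[k + c] x) atTop (𝓝 z) :=
    hz.comp (tendsto_add_atTop_nat c)
  have hlim : ((m : ℝ) + 1) * dist (T z) z ≤
      lam * (dist z (T z) + ∑ _i : Fin (m + 1), dist z z) := by
    refine le_of_tendsto_of_tendsto
      ((tendsto_const_nhds.dist (hshift 1)).const_mul _) ?_ hineq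
    exact (tendsto_const_nhds.add (tendsto_finsetSum _ fun (i : Fin (m + 1)) _ =>
      (hshift (i : ℕ)).dist (hshift ((i : ℕ) + 1)))).const_mul _
  simp only [dist_self, Finset.sum_const_zero, add_zero, dist_comm z] at hlim
  have hd : 0 ≤ dist (T z) z := dist_nonneg
  have hm : (0 : ℝ) ≤ m := by positivity
  exact dist_le_zero.1 (by nlinarith [mul_nonneg hm hd])

/-- An `n`-point Kannan-type mapping on a complete metric space has a periodic point
of prime period `p` for some `p ∈ {1, 2, …, n−1}`. -/
theorem statement9 {X : Type*} [MetricSpace X] [CompleteSpace X] (n : ℕ) (hn : 2 ≤ n)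
    (hcard : ∃ f : Fin n → X, Function.Injective f)
    (T : X → X)
    (lam : ℝ) (hlam0 : 0 ≤ lam) (hlam1 : lam < ((n : ℝ) - 1) / n)
    (hK : ∀ x : Fin n → X, Function.Injective x →
      pairSum (fun i => T (x i)) ≤ lam * ∑ i : Fin n, dist (x i) (T (x i))) :
    ∃ p : ℕ, 1 ≤ p ∧ p ≤ n - 1 ∧
      ∃ x : X, T^[p] x = x ∧ ∀ k : ℕ, 1 ≤ k → k < p → T^[k] x ≠ x := by
  by_contra hcon
  have hper {p : ℕ} (hp : 1 ≤ p) (hpn : p ≤ n - 1) (x : X) : T^[p] x ≠ x := by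
    intro hx
    obtain ⟨q, hq, hqp, hqx⟩ := exists_prime_period_le hp hx
    exact hcon ⟨q, hq, hqp.trans hpn, x, hqx⟩
  have hn' : (2 : ℝ) ≤ n := by exact_mod_cast hn
  have hn0 : (0 : ℝ) < n := by linarith
  have hlamn : lam * n < n - 1 := (lt_div_iff₀ hn0).1 hlam1
  have hlam : lam < 1 := by nlinarith
  have hconsec (y : X) : Function.Injective fun i : Fin n => T^[i] y := by
    refine .of_lt_imp_ne fun i j hij h => ?_
    have hij' : (i : ℕ) < j := hij
    apply hper (p := j - i) (by omega) (by omega) (T^[i] y)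
    rw [← Function.iterate_add_apply, Nat.sub_add_cancel hij'.le]
    exact h.symm
  have hpos : 0 < (1 - lam) * ((n : ℝ) - 1) := mul_pos (by linarith) (by linarith)
  obtain ⟨α, hα⟩ : ∃ α, α = lam / ((1 - lam) * ((n : ℝ) - 1)) := ⟨_, rfl⟩
  have hα0 : 0 ≤ α := hα ▸ div_nonneg hlam0 hpos.le
  have hα1 : α < 1 := by
    rw [hα, div_lt_one hpos]
    linarith
  have hgeom (y : X) (k : ℕ) : dist (T^[k] y) (T^[k + 1] y) ≤ α ^ k * dist y (T y) := by
    induction k with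
    | zero => simp
    | succ k ih =>
      have h := dist_map_le_of_kannan hn hlam0 hlam hK (hconsec (T^[k] y))
      simp only [← hα, ← Function.iterate_succ_apply'] at h
      calc _ ≤ α * dist (T^[k] y) (T^[k + 1] y) := h
        _ ≤ α * (α ^ k * dist y (T y)) := by gcongr
        _ = _ := by ring
  obtain ⟨f, -⟩ := hcard
  let x₀ : X := f ⟨0, by omega⟩
  have hfix (y : X) : T y ≠ y := hper (p := 1) le_rfl (by omega) y
  have horbit : Function.Injective fun k => T^[k] x₀ := by
    refine .of_lt_imp_ne fun i j hij h => ?_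
    have hy : T^[j - i] (T^[i] x₀) = T^[i] x₀ := by
      rw [← Function.iterate_add_apply, Nat.sub_add_cancel hij.le]
      exact h.symm
    have hg := hgeom (T^[i] x₀) (j - i)
    rw [Function.iterate_succ_apply', hy] at hg
    have hd : 0 < dist (T^[i] x₀) (T (T^[i] x₀)) := dist_pos.2 (hfix _).symm
    have hlt : α ^ (j - i) < 1 := pow_lt_one₀ hα0 hα1 (by omega)
    nlinarith
  have hcauchy : CauchySeq fun k => T^[k] x₀ :=
    cauchySeq_of_le_geometric α (dist x₀ (T x₀)) hα1 fun k => by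
      rw [mul_comm]
      exact hgeom x₀ k
  obtain ⟨z, hz⟩ := cauchySeq_tendsto_of_complete hcauchy
  exact hfix z (map_eq_of_kannan_of_tendsto hn hlam hK horbit hz)
end

section
/- Let (X,d) be a metric space with |X| ≥ n ≥ 2, let T : X → X be an n-point Kannan-type mapping, and let x* ∈ X be a fixed point of T. Then T is continuous at x*: for every sequence (x_m) in X with x_m → x*, one has Tx_m → Tx*. -/
open Finset Filter Topology

theorem sum_dist_le_pairSum {X : Type*} [MetricSpace X] {n : ℕ} (x : Fin n → X) (k : Fin n) :
    ∑ j, dist (x k) (x j) ≤ pairSum x := by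
  have hsplit : ∑ j, dist (x k) (x j) =
      ∑ j ∈ Finset.Ioi k, dist (x k) (x j) + ∑ j ∈ Finset.Iio k, dist (x k) (x j) := by
    rw [← Finset.sum_union]
    · symm
      apply Finset.sum_subset (Finset.subset_univ _)
      intro j _ hj
      have : j = k := by
        simp only [Finset.mem_union, Finset.mem_Ioi, Finset.mem_Iio, not_or, not_lt] at hj
        exact le_antisymm hj.1 hj.2
      simp [this]
    · rw [Finset.disjoint_left]
      intro j h₁ h₂
      exact lt_asymm (Finset.mem_Ioi.1 h₁) (Finset.mem_Iio.1 h₂)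
  rw [hsplit, pairSum, ← Finset.add_sum_erase _ _ (Finset.mem_univ k)]
  gcongr
  calc ∑ j ∈ Finset.Iio k, dist (x k) (x j)
      ≤ ∑ i ∈ Finset.Iio k, ∑ j ∈ Finset.Ioi i, dist (x i) (x j) := by
        refine Finset.sum_le_sum fun i hi => ?_
        rw [dist_comm]
        exact Finset.single_le_sum (f := fun j => dist (x i) (x j)) (fun _ _ => dist_nonneg)
          (Finset.mem_Ioi.2 (Finset.mem_Iio.1 hi))
    _ ≤ ∑ i ∈ Finset.univ.erase k, ∑ j ∈ Finset.Ioi i, dist (x i) (x j) := by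
        refine Finset.sum_le_sum_of_subset_of_nonneg (fun i hi => ?_)
          fun _ _ _ => Finset.sum_nonneg fun _ _ => dist_nonneg
        simpa using (Finset.mem_Iio.1 hi).ne

/-- If the Kannan inequality holds for points within `δ` of a fixed point, one of which is the
fixed point itself, then their images are close to the fixed point. -/
theorem dist_fixedPoint_le_of_pairSum_le {X : Type*} [MetricSpace X] {n : ℕ} {T : X → X}
    {lam δ : ℝ} (hlam0 : 0 ≤ lam) {x : Fin n → X}
    (hx : pairSum (fun i => T (x i)) ≤ lam * ∑ i : Fin n, dist (x i) (T (x i)))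
    {k : Fin n} (hk : T (x k) = x k) (hδ : ∀ i, dist (x i) (x k) ≤ δ) (hlam1 : lam < 1)
    (j : Fin n) : (1 - lam) * dist (T (x j)) (x k) ≤ lam * (n * δ) := by
  have hlow := (sum_dist_le_pairSum (fun i => T (x i)) k).trans hx
  simp only [hk] at hlow
  have hup : ∑ i, dist (x i) (T (x i)) ≤ n * δ + ∑ i, dist (x k) (T (x i)) := by
    calc ∑ i, dist (x i) (T (x i)) ≤ ∑ i, (δ + dist (x k) (T (x i))) :=
          Finset.sum_le_sum fun i _ =>
            (dist_triangle _ (x k) _).trans (by linarith [hδ i])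
      _ = n * δ + ∑ i, dist (x k) (T (x i)) := by simp [Finset.sum_add_distrib]
  have hj : dist (T (x j)) (x k) ≤ ∑ i, dist (x k) (T (x i)) := by
    rw [dist_comm]
    exact Finset.single_le_sum (f := fun i => dist (x k) (T (x i)))
      (fun _ _ => dist_nonneg) (Finset.mem_univ j)
  have h₁ := mul_le_mul_of_nonneg_left hup hlam0
  have h₂ := mul_le_mul_of_nonneg_left hj (sub_nonneg.2 hlam1.le)
  linarith

/-- An `n`-point Kannan-type mapping is continuous at each of its fixed points: every
sequence converging to the fixed point is mapped to a sequence converging to its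
image. -/
theorem statement11 {X : Type*} [MetricSpace X] (n : ℕ) (hn : 2 ≤ n)
    (hcard : ∃ f : Fin n → X, Function.Injective f)
    (T : X → X)
    (lam : ℝ) (hlam0 : 0 ≤ lam) (hlam1 : lam < ((n : ℝ) - 1) / n)
    (hK : ∀ x : Fin n → X, Function.Injective x →
      pairSum (fun i => T (x i)) ≤ lam * ∑ i : Fin n, dist (x i) (T (x i)))
    (xs : X) (hxs : T xs = xs) :
    ∀ u : ℕ → X, Filter.Tendsto u Filter.atTop (nhds xs) →
      Filter.Tendsto (fun m => T (u m)) Filter.atTop (nhds (T xs)) := by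
  have hn0 : (0 : ℝ) < n := by positivity
  have hlam : lam < 1 := hlam1.trans (by rw [div_lt_one hn0]; linarith)
  suffices hcont : ContinuousAt T xs from fun u hu => hcont.tendsto.comp hu
  rcases Filter.eq_or_neBot (𝓝[≠] xs) with hiso | hacc
  · rw [← isOpen_singleton_iff_punctured_nhds, isOpen_singleton_iff_nhds_eq_pure] at hiso
    rw [ContinuousAt, hiso]
    exact (tendsto_pure_pure T xs).mono_right (pure_le_nhds _)
  rw [Metric.continuousAt_iff, hxs]
  intro ε hε
  have h1 : 0 < 1 - lam := sub_pos.2 hlam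
  refine ⟨(1 - lam) * ε / n, by positivity, fun {y} hy => ?_⟩
  set δ := (1 - lam) * ε / n with hδ_def
  have hδ : 0 < δ := by positivity
  rcases eq_or_ne y xs with rfl | hne
  · simpa [hxs] using hε
  have hinf : (Metric.ball xs δ).Infinite := infinite_of_mem_nhds xs (Metric.ball_mem_nhds xs hδ)
  classical
  obtain ⟨t, hsub, htball, htcard⟩ : ∃ t : Finset X,
      {xs, y} ⊆ t ∧ (t : Set X) ⊆ Metric.ball xs δ ∧ t.card = n := by
    obtain ⟨s, hs, hscard⟩ := hinf.exists_subset_card_eq n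
    obtain ⟨t, h₁, h₂, h₃⟩ := Finset.exists_subsuperset_card_eq
      (Finset.subset_union_left (s₁ := {xs, y}) (s₂ := s)) (Finset.card_le_two.trans hn)
      (hscard.ge.trans (Finset.card_le_card Finset.subset_union_right))
    refine ⟨t, h₁, fun z hz => ?_, h₃⟩
    rcases Finset.mem_union.1 (h₂ hz) with hz | hz
    · rcases Finset.mem_insert.1 hz with rfl | hz
      · exact Metric.mem_ball_self hδ
      · rwa [Finset.mem_singleton.1 hz]
    · exact hs hz
  let e := (t.equivFinOfCardEq htcard).symm
  let x : Fin n → X := fun i => e i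
  have hxinj : Function.Injective x := Subtype.val_injective.comp e.injective
  obtain ⟨k, hk⟩ : ∃ k, x k = xs :=
    ⟨e.symm ⟨xs, hsub (by simp)⟩, by simp [x]⟩
  obtain ⟨j, hj⟩ : ∃ j, x j = y :=
    ⟨e.symm ⟨y, hsub (by simp)⟩, by simp [x]⟩
  have hmain := dist_fixedPoint_le_of_pairSum_le hlam0 (hK x hxinj) (k := k) (by rw [hk, hxs])
    (fun i => by rw [hk]; exact (Metric.mem_ball.1 (htball (e i).2)).le) hlam j
  rw [hj, hk, hδ_def, mul_div_cancel₀ _ hn0.ne'] at hmain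
  nlinarith [mul_pos h1 hε, mul_pos (mul_pos h1 h1) hε]
end

section
/- Let (X,d) be a complete metric space with |X| ≥ n ≥ 2, and let T : X → X be a continuous, asymptotically regular n-point G-Kannan-type mapping for some function G : ℝ₊ⁿ → ℝ₊ with G(0,…,0) = 0 and G continuous at (0,…,0). Then T has a fixed point in X, and T has at most n−1 fixed points. -/
open Finset Filter Topology

theorem dist_le_pairSum {X : Type*} [MetricSpace X] {n : ℕ} (x : Fin n → X) {i j : Fin n}
    (hij : i < j) : dist (x i) (x j) ≤ pairSum x :=
  (Finset.single_le_sum (f := fun j => dist (x i) (x j)) (fun _ _ => dist_nonneg)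
    (Finset.mem_Ioi.2 hij)).trans
    (Finset.single_le_sum (f := fun i => ∑ j ∈ Finset.Ioi i, dist (x i) (x j))
      (fun _ _ => Finset.sum_nonneg fun _ _ => dist_nonneg) (Finset.mem_univ i))

/-- A periodic point of an asymptotically regular map is a fixed point. -/
theorem apply_eq_of_isPeriodicPt {X : Type*} [MetricSpace X] {T : X → X} {p : X} {k : ℕ}
    (hk : 0 < k) (hp : Function.IsPeriodicPt T k p)
    (har : Tendsto (fun m => dist (T^[m] p) (T^[m + 1] p)) atTop (𝓝 0)) : T p = p := by
  have hmul : Tendsto (fun q : ℕ => k * q) atTop atTop := tendsto_id.const_mul_atTop' hk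
  have hconst : ∀ q : ℕ, dist (T^[k * q] p) (T^[k * q + 1] p) = dist p (T p) := fun q => by
    rw [Function.iterate_succ_apply', (hp.mul_const q).eq]
  have hlim : Tendsto (fun _ : ℕ => dist p (T p)) atTop (𝓝 0) :=
    (har.comp hmul).congr hconst
  exact (dist_eq_zero.1 (tendsto_nhds_unique tendsto_const_nhds hlim)).symm

/-- Orbits of an asymptotically regular map without fixed points do not repeat. -/
theorem injective_iterate_of_forall_ne {X : Type*} [MetricSpace X] {T : X → X}
    (har : ∀ x : X, Tendsto (fun m => dist (T^[m] x) (T^[m + 1] x)) atTop (𝓝 0))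
    (hT : ∀ x, T x ≠ x) (x : X) : Function.Injective fun m => T^[m] x := by
  refine Function.Injective.of_lt_imp_ne fun a b hab h => ?_
  refine hT _ (apply_eq_of_isPeriodicPt (p := T^[a] x) (Nat.sub_pos_of_lt hab) ?_ (har _))
  rw [Function.IsPeriodicPt, Function.IsFixedPt, ← Function.iterate_add_apply,
    Nat.sub_add_cancel hab.le]
  exact h.symm

theorem exists_injective_fin_nat {n N m l : ℕ} (hn : 2 ≤ n) (hm : N ≤ m) (hl : N ≤ l)
    (hml : m ≠ l) : ∃ f : Fin n → ℕ, Function.Injective f ∧ (∀ i, N ≤ f i) ∧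
      f ⟨0, by omega⟩ = m ∧ f ⟨1, by omega⟩ = l := by
  refine ⟨fun i => if i.1 = 0 then m else if i.1 = 1 then l else m + l + i, ?_, ?_, ?_, ?_⟩
  · intro i j h
    apply Fin.ext
    dsimp only at h
    split_ifs at h <;> omega
  · intro i
    dsimp only
    split_ifs <;> omega
  · simp
  · simp

/-- An injective orbit of an asymptotically regular `G`-Kannan-type mapping is Cauchy. -/
theorem cauchySeq_iterate_of_kannan {X : Type*} [MetricSpace X] {n : ℕ} (hn : 2 ≤ n)
    {T : X → X} {G : (Fin n → NNReal) → NNReal} (hG0 : G 0 = 0) (hGc : ContinuousAt G 0)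
    (hK : ∀ x : Fin n → X, Function.Injective x →
      pairSum (fun i => T (x i)) ≤ (G (fun i => nndist (x i) (T (x i))) : ℝ))
    {x : X} (har : Tendsto (fun m => dist (T^[m] x) (T^[m + 1] x)) atTop (𝓝 0))
    (hinj : Function.Injective fun m => T^[m] x) : CauchySeq fun m => T^[m] x := by
  rw [Metric.cauchySeq_iff]
  intro ε hε
  have hGc' : Tendsto (fun v => (G v : ℝ)) (𝓝 0) (𝓝 0) := by
    have := (NNReal.continuous_coe.tendsto _).comp hGc.tendsto
    simpa [hG0, Function.comp_def] using this
  obtain ⟨δ, hδ, hball⟩ := Metric.eventually_nhds_iff.1 (hGc'.eventually_lt_const hε)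
  obtain ⟨N, hN⟩ := eventually_atTop.1 (har.eventually_lt_const hδ)
  have key : ∀ m ≥ N, ∀ l ≥ N, dist (T^[m + 1] x) (T^[l + 1] x) < ε := by
    intro m hm l hl
    rcases eq_or_ne m l with rfl | hml
    · simpa using hε
    obtain ⟨f, hf, hfN, hf0, hf1⟩ := exists_injective_fin_nat hn hm hl hml
    have hlt : (⟨0, by omega⟩ : Fin n) < ⟨1, by omega⟩ := Fin.mk_lt_mk.2 one_pos
    have h1 := dist_le_pairSum (fun i => T (T^[f i] x)) hlt
    have h2 := hK (fun i => T^[f i] x) (hinj.comp hf)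
    have h3 : (G (fun i => nndist (T^[f i] x) (T (T^[f i] x))) : ℝ) < ε := by
      refine hball ((dist_pi_lt_iff hδ).2 fun i => ?_)
      have := hN (f i) (hfN i)
      rw [Function.iterate_succ_apply'] at this
      simpa [NNReal.dist_eq] using this
    simp only [hf0, hf1] at h1
    rw [Function.iterate_succ_apply', Function.iterate_succ_apply']
    exact (h1.trans h2).trans_lt h3
  refine ⟨N + 1, fun m hm l hl => ?_⟩
  have := key (m - 1) (by omega) (l - 1) (by omega)
  rwa [Nat.sub_add_cancel (by omega), Nat.sub_add_cancel (by omega)] at this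

/-- A continuous, asymptotically regular `n`-point `G`-Kannan-type mapping on a
complete metric space (where `G : ℝ₊ⁿ → ℝ₊` vanishes at the origin and is continuous
there) has a fixed point, and has at most `n−1` fixed points. -/
theorem statement14 {X : Type*} [MetricSpace X] [CompleteSpace X] (n : ℕ) (hn : 2 ≤ n)
    (hcard : ∃ f : Fin n → X, Function.Injective f)
    (T : X → X) (hTc : Continuous T)
    (har : ∀ x : X,
      Filter.Tendsto (fun m => dist (T^[m] x) (T^[m + 1] x)) Filter.atTop (nhds 0))
    (G : (Fin n → NNReal) → NNReal) (hG0 : G 0 = 0) (hGc : ContinuousAt G 0)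
    (hK : ∀ x : Fin n → X, Function.Injective x →
      pairSum (fun i => T (x i)) ≤ (G (fun i => nndist (x i) (T (x i))) : ℝ)) :
    (∃ w : X, T w = w) ∧
    ¬∃ w : Fin n → X, Function.Injective w ∧ ∀ i, T (w i) = w i := by
  constructor
  · by_contra! hT
    obtain ⟨f, -⟩ := hcard
    let x := f ⟨0, by omega⟩
    obtain ⟨w, hw⟩ := cauchySeq_tendsto_of_complete (cauchySeq_iterate_of_kannan hn hG0 hGc hK
      (har x) (injective_iterate_of_forall_ne har hT x))
    exact hT w (isFixedPt_of_tendsto_iterate hw hTc.continuousAt)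
  · rintro ⟨w, hw, hfix⟩
    have hlt : (⟨0, by omega⟩ : Fin n) < ⟨1, by omega⟩ := Fin.mk_lt_mk.2 one_pos
    have h1 := dist_le_pairSum w hlt
    have h2 := hK w hw
    have h3 : (fun i => nndist (w i) (w i)) = (0 : Fin n → NNReal) := by
      ext i
      simp
    simp only [hfix, h3, hG0, NNReal.coe_zero] at h2
    exact (dist_pos.2 (hw.ne hlt.ne)).not_ge (h1.trans h2)
end
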